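/- arXiv:2104.09975 — 5 statements merged into one kernel-verified Lean document; each statement's English description precedes it below -/
import Mathlib

section
/- If a morphism w in M is a fibration (of the original structure) and has property P_fib, then w has property P, i.e. every pullback of w (along an arbitrary morphism of M) is in W_loc. -/
open CategoryTheory CategoryTheory.Limits

universe w v u

namespace Paper

variable {C : Type u} [Category.{v} C]

/-- `f` is a retract of `g` in the arrow category of `C`. -/
def IsRetractOf {X Y X' Y' : C} (f : X ⟶ Y) (g : X' ⟶ Y') : Prop :=
  ∃ (i : Arrow.mk f ⟶ Arrow.mk g) (r : Arrow.mk g ⟶ Arrow.mk f), i ≫ r = 𝟙 _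

/-- A model structure on a (complete and cocomplete) category `C`, given by classes of
cofibrations, fibrations and weak equivalences satisfying the usual axioms. -/
structure ModelStructure (C : Type u) [Category.{v} C] where
  cof : MorphismProperty C
  fib : MorphismProperty C
  weq : MorphismProperty C
  weq_comp : ∀ {X Y Z : C} (f : X ⟶ Y) (g : Y ⟶ Z), weq f → weq g → weq (f ≫ g)
  weq_of_comp_right : ∀ {X Y Z : C} (f : X ⟶ Y) (g : Y ⟶ Z), weq g → weq (f ≫ g) → weq f
  weq_of_comp_left : ∀ {X Y Z : C} (f : X ⟶ Y) (g : Y ⟶ Z), weq f → weq (f ≫ g) → weq g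
  cof_retract : ∀ {X Y X' Y' : C} (f : X ⟶ Y) (g : X' ⟶ Y'), IsRetractOf f g → cof g → cof f
  fib_retract : ∀ {X Y X' Y' : C} (f : X ⟶ Y) (g : X' ⟶ Y'), IsRetractOf f g → fib g → fib f
  weq_retract : ∀ {X Y X' Y' : C} (f : X ⟶ Y) (g : X' ⟶ Y'), IsRetractOf f g → weq g → weq f
  lifting_trivCof : ∀ {A B X Y : C} (i : A ⟶ B) (p : X ⟶ Y),
    cof i → weq i → fib p → HasLiftingProperty i p
  lifting_trivFib : ∀ {A B X Y : C} (i : A ⟶ B) (p : X ⟶ Y),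
    cof i → fib p → weq p → HasLiftingProperty i p
  factor_trivCof_fib : ∀ {X Y : C} (f : X ⟶ Y),
    ∃ (Z : C) (i : X ⟶ Z) (p : Z ⟶ Y), cof i ∧ weq i ∧ fib p ∧ i ≫ p = f
  factor_cof_trivFib : ∀ {X Y : C} (f : X ⟶ Y),
    ∃ (Z : C) (i : X ⟶ Z) (p : Z ⟶ Y), cof i ∧ fib p ∧ weq p ∧ i ≫ p = f

/-- Right properness: weak equivalences are stable under pullback along fibrations. -/
def ModelStructure.RightProper (M : ModelStructure C) : Prop :=
  ∀ ⦃P X Y' Y : C⦄ (fst : P ⟶ X) (snd : P ⟶ Y') (f : X ⟶ Y) (g : Y' ⟶ Y),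
    M.weq f → M.fib g → IsPullback fst snd f g → M.weq snd

/-- Left properness: weak equivalences are stable under pushout along cofibrations. -/
def ModelStructure.LeftProper (M : ModelStructure C) : Prop :=
  ∀ ⦃X Y Z P : C⦄ (f : X ⟶ Y) (g : X ⟶ Z) (inl : Y ⟶ P) (inr : Z ⟶ P),
    M.weq f → M.cof g → IsPushout f g inl inr → M.weq inr

/-- A left Bousfield localization of `M`: a second model structure with the same cofibrations
and a larger class of weak equivalences. -/
structure ModelStructure.IsBousfieldLocalization (M Mloc : ModelStructure C) : Prop where
  cof_eq : Mloc.cof = M.cof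
  weq_le : M.weq ≤ Mloc.weq

/-- A morphism has property `P` (w.r.t. a class `W`) if every pullback of it lies in `W`. -/
def PropertyP (W : MorphismProperty C) {X Y : C} (f : X ⟶ Y) : Prop :=
  ∀ ⦃P Y' : C⦄ (fst : P ⟶ X) (snd : P ⟶ Y') (g : Y' ⟶ Y), IsPullback fst snd f g → W snd

/-- A morphism has property `P_fib` (w.r.t. classes `F` of fibrations and `W`) if every
pullback of it along a morphism of `F` lies in `W`. -/
def PropertyPfib (F W : MorphismProperty C) {X Y : C} (f : X ⟶ Y) : Prop :=
  ∀ ⦃P Y' : C⦄ (fst : P ⟶ X) (snd : P ⟶ Y') (g : Y' ⟶ Y),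
    F g → IsPullback fst snd f g → W snd

namespace ModelStructure

lemma fib_of_rlp (M : ModelStructure C) {X Y : C} (f : X ⟶ Y) (hf : (M.cof ⊓ M.weq).rlp f) :
    M.fib f := by
  obtain ⟨Z, i, p, hi, hi', hp, fac⟩ := M.factor_trivCof_fib f
  have := hf i ⟨hi, hi'⟩
  let r := RetractArrow.ofRightLiftingProperty fac
  exact M.fib_retract f p ⟨r.i, r.r, r.retract⟩ hp

lemma fib_eq_rlp (M : ModelStructure C) : M.fib = (M.cof ⊓ M.weq).rlp :=
  le_antisymm (fun _ _ f hf _ _ i hi => M.lifting_trivCof i f hi.1 hi.2 hf)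
    fun _ _ f hf => M.fib_of_rlp f hf

lemma isStableUnderBaseChange_fib (M : ModelStructure C) : M.fib.IsStableUnderBaseChange := by
  rw [fib_eq_rlp]
  infer_instance

end ModelStructure

end Paper

open Paper

theorem stmt0 {C : Type u} [Category.{v} C] [HasLimits C] [HasColimits C]
    (M Mloc : ModelStructure C) (hloc : M.IsBousfieldLocalization Mloc)
    (hproper : M.RightProper)
    {X Y : C} (w : X ⟶ Y) (hw : M.fib w)
    (hPfib : PropertyPfib M.fib Mloc.weq w) :
    PropertyP Mloc.weq w := by
  intro P Y' fst snd g h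
  obtain ⟨Z, i, p, -, hi, hp, rfl⟩ := M.factor_trivCof_fib g
  have hQ := IsPullback.of_hasPullback w p
  let l : P ⟶ pullback w p := pullback.lift fst (snd ≫ i) (by simpa using h.w)
  have hl₁ : l ≫ pullback.fst w p = fst := pullback.lift_fst _ _ _
  have hl : l ≫ pullback.snd w p = snd ≫ i := pullback.lift_snd _ _ _
  have hP : IsPullback l snd (pullback.snd w p) i :=
    IsPullback.of_right (by rwa [hl₁]) hl hQ
  have := M.isStableUnderBaseChange_fib
  have hs : M.fib (pullback.snd w p) := MorphismProperty.of_isPullback hQ hw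
  have hl' : M.weq l := hproper snd l i _ hi hs hP.flip
  refine Mloc.weq_of_comp_right snd i (hloc.weq_le _ hi) ?_
  rw [← hl]
  exact Mloc.weq_comp _ _ (hloc.weq_le _ hl') (hPfib _ _ _ hp hQ)
end

section
/- Let f = h ∘ g be a composition of morphisms in M such that g has property P_fib. Then f has property P_fib if and only if h has property P_fib. -/
open CategoryTheory CategoryTheory.Limits

universe w v u

open Paper


namespace Paper

variable {C : Type u} [Category.{v} C]

/-- A morphism with the right lifting property against trivial cofibrations is a fibration. -/
theorem ModelStructure.fib_of_hasLiftingProperty (M : ModelStructure C) {X Y : C} (f : X ⟶ Y)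
    (hf : ∀ {A B : C} (i : A ⟶ B), M.cof i → M.weq i → HasLiftingProperty i f) : M.fib f := by
  obtain ⟨Z, i, p, hi, hi', hp, fac⟩ := M.factor_trivCof_fib f
  have := hf i hi hi'
  have sq : CommSq (𝟙 X) i f p := ⟨by simp [fac]⟩
  refine M.fib_retract f p ⟨Arrow.homMk i (𝟙 Y) (by simp [fac]),
    Arrow.homMk sq.lift (𝟙 Y) (by simp), ?_⟩ hp
  ext <;> simp

/-- Fibrations are stable under base change. -/
theorem ModelStructure.fib_of_isPullback (M : ModelStructure C) {P X Y' Y : C}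
    {fst : P ⟶ X} {snd : P ⟶ Y'} {f : X ⟶ Y} {g : Y' ⟶ Y}
    (sq : IsPullback fst snd f g) (hg : M.fib g) : M.fib fst := by
  refine M.fib_of_hasLiftingProperty fst fun i hi hi' => ?_
  have := M.lifting_trivCof i g hi hi' hg
  exact sq.flip.hasLiftingProperty i

end Paper

/-- If `f = h ∘ g` and `g` has property `P_fib`, then `f` has property `P_fib` if and only if
`h` has property `P_fib`. -/
theorem stmt1 {C : Type u} [Category.{v} C] [HasLimits C] [HasColimits C]
    (M Mloc : ModelStructure C) (hloc : M.IsBousfieldLocalization Mloc)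
    (hproper : M.RightProper)
    {X Y Z : C} (g : X ⟶ Y) (h : Y ⟶ Z)
    (hg : PropertyPfib M.fib Mloc.weq g) :
    PropertyPfib M.fib Mloc.weq (g ≫ h) ↔ PropertyPfib M.fib Mloc.weq h := by
  constructor
  · intro hgh Q Z' fst snd p hp sq
    have sq' := IsPullback.of_hasPullback g fst
    exact Mloc.weq_of_comp_left _ snd (hg _ _ _ (M.fib_of_isPullback sq hp) sq')
      (hgh _ _ _ hp (sq'.paste_vert sq))
  · intro hh P Z' fst snd p hp sq
    have sq₂ := IsPullback.of_hasPullback h p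
    have w : (fst ≫ g) ≫ h = snd ≫ p := by simpa using sq.w
    obtain ⟨l, hl₁, hl₂⟩ := sq₂.exists_lift (fst ≫ g) snd w
    have sq₁ : IsPullback fst l g (pullback.fst h p) :=
      IsPullback.of_bot (by rwa [hl₂]) hl₁.symm sq₂
    rw [← hl₂]
    exact Mloc.weq_comp _ _ (hg _ _ _ (M.fib_of_isPullback sq₂ hp) sq₁) (hh _ _ _ hp sq₂)
end

section
/- Assume that every morphism of W_loc has property P_fib (equivalently, W_loc is stable under pullback along morphisms in Fib). Let μ be a morphism of cospan diagrams (X → Y ← Z) → (X' → Y' ← Z') in M in which all four structure morphisms X → Y, Z → Y, X' → Y', Z' → Y' are in Fib, all six objects are fibrant (for the original structure), and the three components X → X', Y → Y', Z → Z' of μ are in W_loc. Then the induced morphism between pullbacks X ×_Y Z → X' ×_{Y'} Z' is in W_loc. -/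
open CategoryTheory CategoryTheory.Limits

universe w v u

open Paper


namespace Paper

variable {C : Type u} [Category.{v} C]

/-- The retract argument: fibrations are the maps with the right lifting property against
trivial cofibrations. -/
lemma ModelStructure.fib_eq_rlp_s3 (M : ModelStructure C) : M.fib = (M.cof ⊓ M.weq).rlp := by
  ext X Y p
  refine ⟨fun hp A B i hi => M.lifting_trivCof i p hi.1 hi.2 hp, fun hp => ?_⟩
  obtain ⟨Z, i, q, hi, hi', hq, rfl⟩ := M.factor_trivCof_fib p
  have := hp i ⟨hi, hi'⟩
  have sq : CommSq (𝟙 X) i (i ≫ q) q := ⟨by simp⟩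
  exact M.fib_retract _ q ⟨Arrow.homMk i (𝟙 Y) (by simp), Arrow.homMk sq.lift (𝟙 Y) (by simp),
    by ext <;> simp⟩ hq

lemma ModelStructure.isStableUnderBaseChange_fib_s3 (M : ModelStructure C) :
    M.fib.IsStableUnderBaseChange := by
  rw [M.fib_eq_rlp_s3]
  infer_instance

variable [HasPullbacks C] {X Y Z X' Y' Z' : C} {f : X ⟶ Y} {g : Z ⟶ Y} {f' : X' ⟶ Y'}
  {g' : Z' ⟶ Y'} {μX : X ⟶ X'} {μY : Y ⟶ Y'} {μZ : Z ⟶ Z'}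

/-- If the left square of a morphism of cospans is cartesian, then the induced map on pullbacks is
a base change of the right component. -/
lemma isPullback_map_of_isPullback_left (h : IsPullback μX f f' μY) (h₂ : g ≫ μY = μZ ≫ g') :
    IsPullback (pullback.snd f g) (pullback.map f g f' g' μX μZ μY h.w.symm h₂) μZ
      (pullback.snd f' g') := by
  refine (IsPullback.of_right (h₁₂ := pullback.fst f' g') (h₂₂ := g') (v₁₃ := f') ?_
    (by simp [pullback.lift_snd]) (IsPullback.of_hasPullback f' g')).flip
  rw [← h₂]
  simpa [pullback.lift_fst] using (IsPullback.of_hasPullback f g).paste_horiz h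

/-- If the right square of a morphism of cospans is cartesian, then the induced map on pullbacks is
a base change of the left component. -/
lemma isPullback_map_of_isPullback_right (h₁ : f ≫ μY = μX ≫ f') (h : IsPullback μZ g g' μY) :
    IsPullback (pullback.fst f g) (pullback.map f g f' g' μX μZ μY h₁ h.w.symm) μX
      (pullback.fst f' g') := by
  refine (IsPullback.of_right (h₁₂ := pullback.snd f' g') (h₂₂ := f') (v₁₃ := g') ?_
    (by simp [pullback.lift_fst]) (IsPullback.of_hasPullback f' g').flip).flip
  rw [← h₁]
  simpa [pullback.lift_snd] using (IsPullback.of_hasPullback f g).flip.paste_horiz h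

end Paper

/-- If every morphism of `W_loc` has property `P_fib`, then for a morphism of cospans of
fibrations between fibrant objects which is pointwise in `W_loc`, the induced morphism between
the pullbacks is in `W_loc`. -/
theorem stmt3 {C : Type u} [Category.{v} C] [HasLimits C] [HasColimits C]
    (M Mloc : ModelStructure C) (hloc : M.IsBousfieldLocalization Mloc)
    (hproper : M.RightProper)
    (hPfib : ∀ ⦃A B : C⦄ (f : A ⟶ B), Mloc.weq f → PropertyPfib M.fib Mloc.weq f)
    {X Y Z X' Y' Z' : C}
    (f : X ⟶ Y) (g : Z ⟶ Y) (f' : X' ⟶ Y') (g' : Z' ⟶ Y')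
    (hf : M.fib f) (hg : M.fib g) (hf' : M.fib f') (hg' : M.fib g')
    (hXfib : M.fib (terminal.from X)) (hYfib : M.fib (terminal.from Y))
    (hZfib : M.fib (terminal.from Z)) (hX'fib : M.fib (terminal.from X'))
    (hY'fib : M.fib (terminal.from Y')) (hZ'fib : M.fib (terminal.from Z'))
    (μX : X ⟶ X') (μY : Y ⟶ Y') (μZ : Z ⟶ Z')
    (hμX : Mloc.weq μX) (hμY : Mloc.weq μY) (hμZ : Mloc.weq μZ)
    (hsq₁ : f ≫ μY = μX ≫ f') (hsq₂ : g ≫ μY = μZ ≫ g') :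
    Mloc.weq (pullback.map f g f' g' μX μZ μY hsq₁ hsq₂) := by
  have := M.isStableUnderBaseChange_fib_s3
  have cart := IsPullback.of_hasPullback f' μY
  let a : X ⟶ pullback f' μY := pullback.lift μX f hsq₁.symm
  have ha : Mloc.weq a := by
    refine Mloc.weq_of_comp_right a (pullback.fst f' μY) ?_ (by simpa [a, pullback.lift_fst] using hμX)
    exact hPfib μY hμY _ _ f' hf' cart.flip
  have w₁ : f ≫ 𝟙 Y = a ≫ pullback.snd f' μY := by simp [a, pullback.lift_snd]
  have key : pullback.map f g f' g' μX μZ μY hsq₁ hsq₂ =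
      pullback.map f g (pullback.snd f' μY) g a (𝟙 Z) (𝟙 Y) w₁ (by simp) ≫
        pullback.map (pullback.snd f' μY) g f' g' (pullback.fst f' μY) μZ μY
          cart.w.symm hsq₂ := by
    ext <;>
      simp [a, pullback.lift_fst, pullback.lift_snd, pullback.lift_fst_assoc, pullback.lift_snd_assoc]
  rw [key]
  refine Mloc.weq_comp _ _ ?_ ?_
  · exact hPfib a ha _ _ _ (M.fib.pullback_fst _ _ hg)
      (isPullback_map_of_isPullback_right w₁ (IsPullback.of_vert_isIso ⟨by simp⟩).flip)
  · exact hPfib μZ hμZ _ _ _ (M.fib.pullback_snd _ _ hf')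
      (isPullback_map_of_isPullback_left cart hsq₂)
end

section
/- Assume that every morphism of W_loc has property P_fib, and let p: Y → Y' be a morphism in Fib ∩ W_loc. Then the diagonal morphism Y → Y ×_{Y'} Y is in W_loc. -/
open CategoryTheory CategoryTheory.Limits

universe w v u

open Paper


/-- If every morphism of `W_loc` has property `P_fib` and `p : Y ⟶ Y'` is in `Fib ∩ W_loc`,
then the diagonal morphism `Y ⟶ Y ×_{Y'} Y` is in `W_loc`. -/
theorem stmt4 {C : Type u} [Category.{v} C] [HasLimits C] [HasColimits C]
    (M Mloc : ModelStructure C) (hloc : M.IsBousfieldLocalization Mloc)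
    (hproper : M.RightProper)
    (hPfib : ∀ ⦃A B : C⦄ (f : A ⟶ B), Mloc.weq f → PropertyPfib M.fib Mloc.weq f)
    {Y Y' : C} (p : Y ⟶ Y') (hpfib : M.fib p) (hpweq : Mloc.weq p) :
    Mloc.weq (pullback.diagonal p) := by
  have h_snd : Mloc.weq (pullback.snd p p) :=
    hPfib p hpweq _ _ p hpfib (IsPullback.of_hasPullback p p)
  have h_id : Mloc.weq (𝟙 Y) :=
    Mloc.weq_of_comp_right (𝟙 Y) p hpweq (by rwa [Category.id_comp])
  exact Mloc.weq_of_comp_right _ (pullback.snd p p) h_snd (by rwa [pullback.diagonal_snd])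
end

section
/- If a morphism f of M has the property that every pullback of f along a fibration with cofibrant source (respectively, along an arbitrary morphism with cofibrant source) is in W_loc, then f has property P_fib (respectively, property P). -/
open CategoryTheory CategoryTheory.Limits

universe w v u

open Paper


namespace Paper

variable {C : Type u} [Category.{v} C]

/-- The retract argument: if `p = i ≫ q` and `p` has the right lifting property against `i`,
then `p` is a retract of `q`. -/
lemma isRetractOf_of_hasLiftingProperty {X Y Z : C} {p : X ⟶ Y} {i : X ⟶ Z} {q : Z ⟶ Y}
    (hfac : i ≫ q = p) [HasLiftingProperty i p] : IsRetractOf p q := by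
  have sq : CommSq (𝟙 X) i p q := ⟨by simp [hfac]⟩
  refine ⟨Arrow.homMk i (𝟙 Y) (by simp [hfac]), Arrow.homMk sq.lift (𝟙 Y) (by simp), ?_⟩
  ext <;> simp

namespace ModelStructure

variable (M : ModelStructure C)

lemma fib_of_hasLiftingProperty_s10 {X Y : C} (p : X ⟶ Y)
    (h : ∀ {A B : C} (i : A ⟶ B), M.cof i → M.weq i → HasLiftingProperty i p) : M.fib p := by
  obtain ⟨Z, i, q, hi, hi', hq, hfac⟩ := M.factor_trivCof_fib p
  have := h i hi hi'
  exact M.fib_retract _ _ (isRetractOf_of_hasLiftingProperty hfac) hq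

lemma weq_of_hasLiftingProperty {X Y : C} (p : X ⟶ Y)
    (h : ∀ {A B : C} (i : A ⟶ B), M.cof i → HasLiftingProperty i p) : M.weq p := by
  obtain ⟨Z, i, q, hi, -, hq, hfac⟩ := M.factor_cof_trivFib p
  have := h i hi
  exact M.weq_retract _ _ (isRetractOf_of_hasLiftingProperty hfac) hq

lemma fib_comp {X Y Z : C} (p : X ⟶ Y) (q : Y ⟶ Z) (hp : M.fib p) (hq : M.fib q) :
    M.fib (p ≫ q) := by
  refine M.fib_of_hasLiftingProperty_s10 _ fun i hi hi' => ?_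
  have := M.lifting_trivCof i p hi hi' hp
  have := M.lifting_trivCof i q hi hi' hq
  infer_instance

lemma weq_of_isPullback_trivFib {P X Y Z : C} {fst : P ⟶ X} {snd : P ⟶ Z} {f : X ⟶ Y}
    {q : Z ⟶ Y} (h : IsPullback fst snd f q) (hq : M.fib q) (hq' : M.weq q) : M.weq fst := by
  refine M.weq_of_hasLiftingProperty _ fun i hi => ?_
  have := M.lifting_trivFib i q hi hq hq'
  exact h.flip.hasLiftingProperty i

/-- A morphism is a weak equivalence in a localization as soon as its base change along some
trivial fibration is. -/
lemma IsBousfieldLocalization.weq_of_isPullback_trivFib {M Mloc : ModelStructure C}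
    (hloc : M.IsBousfieldLocalization Mloc) {P Q Y' Z : C} {snd : P ⟶ Y'} {q : Z ⟶ Y'}
    {fst' : Q ⟶ P} {snd' : Q ⟶ Z} (h : IsPullback fst' snd' snd q)
    (hq : M.fib q) (hq' : M.weq q) (hsnd' : Mloc.weq snd') : Mloc.weq snd := by
  refine Mloc.weq_of_comp_left fst' snd
    (hloc.weq_le _ (M.weq_of_isPullback_trivFib h hq hq')) ?_
  rw [h.w]
  exact Mloc.weq_comp _ _ hsnd' (hloc.weq_le _ hq')

end ModelStructure

end Paper

/-- If every pullback of `f` along a fibration with cofibrant source is in `W_loc`, then `f`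
has property `P_fib`; respectively, if every pullback of `f` along an arbitrary morphism with
cofibrant source is in `W_loc`, then `f` has property `P`. -/
theorem stmt10 {C : Type u} [Category.{v} C] [HasLimits C] [HasColimits C]
    (M Mloc : ModelStructure C) (hloc : M.IsBousfieldLocalization Mloc)
    (hproper : M.RightProper)
    {X Y : C} (f : X ⟶ Y) :
    ((∀ ⦃P Y' : C⦄ (fst : P ⟶ X) (snd : P ⟶ Y') (g : Y' ⟶ Y),
        M.fib g → M.cof (initial.to Y') → IsPullback fst snd f g → Mloc.weq snd) →
      PropertyPfib M.fib Mloc.weq f) ∧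
    ((∀ ⦃P Y' : C⦄ (fst : P ⟶ X) (snd : P ⟶ Y') (g : Y' ⟶ Y),
        M.cof (initial.to Y') → IsPullback fst snd f g → Mloc.weq snd) →
      PropertyP Mloc.weq f) := by
  refine ⟨fun H P Y' fst snd g hg hpb => ?_, fun H P Y' fst snd g hpb => ?_⟩
  all_goals
    obtain ⟨Z, i, q, hi, hq, hq', hfac⟩ := M.factor_cof_trivFib (initial.to Y')
    obtain rfl : i = initial.to Z := Subsingleton.elim _ _
    have hQ := IsPullback.of_hasPullback snd q
    refine hloc.weq_of_isPullback_trivFib hQ hq hq' ?_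
  · exact H _ _ (q ≫ g) (M.fib_comp q g hq hg) hi (hQ.paste_horiz hpb)
  · exact H _ _ (q ≫ g) hi (hQ.paste_horiz hpb)
end
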